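/- Let M be a separative quasi-divisible refinement cone and let a ∈ M. Then M(a) is a simple, separative, quasi-divisible refinement cone. -/

import Mathlib

universe u

/-- Conical commutative monoid ("cone"): `x + y = 0` implies `x = y = 0`. -/
def IsConical (M : Type u) [AddCommMonoid M] : Prop :=
  ∀ x y : M, x + y = 0 → x = 0 ∧ y = 0

/-- Algebraic preorder: `x ≤ y` iff `∃ z, x + z = y`. -/
def AlgLE {M : Type u} [AddCommMonoid M] (x y : M) : Prop :=
  ∃ z : M, x + z = y

/-- Refinement monoid. -/
def IsRefinementMonoid (M : Type u) [AddCommMonoid M] : Prop :=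
  ∀ a₀ a₁ b₀ b₁ : M, a₀ + a₁ = b₀ + b₁ →
    ∃ c₀₀ c₀₁ c₁₀ c₁₁ : M,
      a₀ = c₀₀ + c₀₁ ∧ a₁ = c₁₀ + c₁₁ ∧ b₀ = c₀₀ + c₁₀ ∧ b₁ = c₀₁ + c₁₁

/-- Unitary homomorphism: injective, cofinal image, and `f a₀ + b = f a₁ → b ∈ range f`. -/
def IsUnitary {A : Type u} {B : Type u} [AddCommMonoid A] [AddCommMonoid B]
    (f : A →+ B) : Prop :=
  Function.Injective f ∧
  (∀ b : B, ∃ a : A, AlgLE b (f a)) ∧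
  (∀ a₀ a₁ : A, ∀ b : B, f a₀ + b = f a₁ → b ∈ Set.range f)

/-- Strongly unitary homomorphism. -/
def IsStronglyUnitary {A : Type u} {B : Type u} [AddCommMonoid A] [AddCommMonoid B]
    (f : A →+ B) : Prop :=
  IsUnitary f ∧ ∀ m : ℕ, 0 < m → ∀ b : B, m • b ∈ Set.range f → b ∈ Set.range f

/-- Normally divisible commutative monoid. -/
def IsNormallyDivisible (M : Type u) [AddCommMonoid M] : Prop :=
  ∀ p : ℕ, 0 < p → ∀ X : Finset M, ∀ a : M,
    ∃ u : M, p • u = a ∧ ∀ x ∈ X, ∀ y ∈ X, x + a = y + a → x + u = y + u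

/-- Order-embedding of commutative monoids (w.r.t. the algebraic preorders). -/
def IsOrderEmbeddingHom {A : Type u} {B : Type u} [AddCommMonoid A] [AddCommMonoid B]
    (f : A →+ B) : Prop :=
  Function.Injective f ∧ ∀ x y : A, AlgLE x y ↔ AlgLE (f x) (f y)

/-- Simple commutative monoid: every `u ≰ 0` is an order-unit. -/
def IsSimpleMonoid (M : Type u) [AddCommMonoid M] : Prop :=
  ∀ u : M, ¬ AlgLE u 0 → ∀ x : M, ∃ n : ℕ, 0 < n ∧ AlgLE x (n • u)

/-- Weak sum decomposition axiom (WSD). -/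
def WSD (M : Type u) [AddCommMonoid M] : Prop :=
  ∀ a₀ a₁ b c : M, a₀ + a₁ + c = b + c →
    ∃ x₀ x₁ : M, a₀ + c = x₀ + c ∧ a₁ + c = x₁ + c ∧ b = x₀ + x₁

/-- `a ∝ b` : `a ≤ n • b` for some positive integer `n`. -/
def Propto {M : Type u} [AddCommMonoid M] (a b : M) : Prop :=
  ∃ n : ℕ, 0 < n ∧ AlgLE a (n • b)

/-- `a ≍ b` : `a ∝ b` and `b ∝ a`. -/
def Asymp {M : Type u} [AddCommMonoid M] (a b : M) : Prop :=
  Propto a b ∧ Propto b a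

/-- Cancellative commutative monoid. -/
def IsCancellativeMonoid (M : Type u) [AddCommMonoid M] : Prop :=
  ∀ x y z : M, x + z = y + z → x = y

/-- Separative commutative monoid. -/
def IsSeparative (M : Type u) [AddCommMonoid M] : Prop :=
  ∀ x y : M, 2 • x = x + y → x + y = 2 • y → x = y

/-- Stably finite commutative monoid. -/
def IsStablyFinite (M : Type u) [AddCommMonoid M] : Prop :=
  ∀ x y : M, x + y = y → x = 0

/-- Quasi-divisible commutative monoid. -/
def IsQuasiDivisible (M : Type u) [AddCommMonoid M] : Prop :=
  ∀ x : M, ∃ u v : M, 2 • u + 3 • v = x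

/-- `ℙ`-torsion-free commutative monoid. -/
def PTorsionFree (P : Set ℕ) (M : Type u) [AddCommMonoid M] : Prop :=
  ∀ p ∈ P, ∀ x y : M, p • x = p • y → x = y

/-- `ℙ`-unperforated commutative monoid (w.r.t. the algebraic preorder). -/
def PUnperforated (P : Set ℕ) (M : Type u) [AddCommMonoid M] : Prop :=
  ∀ p ∈ P, ∀ x y : M, AlgLE (p • x) (p • y) → AlgLE x y

section

variable {M : Type u} [AddCommMonoid M]

theorem AlgLE.refl (x : M) : AlgLE x x := ⟨0, add_zero x⟩

theorem AlgLE.trans {x y z : M} (h : AlgLE x y) (h' : AlgLE y z) : AlgLE x z := by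
  obtain ⟨s, rfl⟩ := h
  obtain ⟨t, rfl⟩ := h'
  exact ⟨s + t, (add_assoc x s t).symm⟩

theorem AlgLE.add {x y z w : M} (h : AlgLE x y) (h' : AlgLE z w) : AlgLE (x + z) (y + w) := by
  obtain ⟨s, rfl⟩ := h
  obtain ⟨t, rfl⟩ := h'
  exact ⟨s + t, add_add_add_comm x z s t⟩

theorem AlgLE.nsmul {x y : M} (h : AlgLE x y) (n : ℕ) : AlgLE (n • x) (n • y) := by
  obtain ⟨s, rfl⟩ := h
  exact ⟨n • s, (nsmul_add x s n).symm⟩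

theorem AlgLE.add_right (x y : M) : AlgLE x (x + y) := ⟨y, rfl⟩

theorem AlgLE.add_left (x y : M) : AlgLE x (y + x) := ⟨y, add_comm x y⟩

theorem AlgLE.propto {x y : M} (h : AlgLE x y) : Propto x y :=
  ⟨1, one_pos, by rwa [one_nsmul]⟩

theorem Propto.trans {x y z : M} (h : Propto x y) (h' : Propto y z) : Propto x z := by
  obtain ⟨m, hm, h⟩ := h
  obtain ⟨n, hn, h'⟩ := h'
  refine ⟨n * m, Nat.mul_pos hn hm, h.trans ?_⟩
  rw [mul_nsmul]
  exact h'.nsmul m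

theorem Propto.add {x y z : M} (h : Propto x z) (h' : Propto y z) : Propto (x + y) z := by
  obtain ⟨m, hm, h⟩ := h
  obtain ⟨n, -, h'⟩ := h'
  refine ⟨m + n, Nat.add_pos_left hm n, ?_⟩
  rw [add_nsmul]
  exact h.add h'

/-- The Riesz decomposition property of refinement monoids. -/
theorem IsRefinementMonoid.exists_add_of_algLE_add (href : IsRefinementMonoid M) {x y z : M}
    (h : AlgLE x (y + z)) : ∃ s t : M, x = s + t ∧ AlgLE s y ∧ AlgLE t z := by
  obtain ⟨w, hw⟩ := h
  obtain ⟨p, q, r, s, hx, -, hy, hz⟩ := href x w y z hw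
  exact ⟨p, q, hx, ⟨r, hy.symm⟩, ⟨s, hz.symm⟩⟩

theorem IsRefinementMonoid.exists_add_of_propto_add (href : IsRefinementMonoid M) {x y z : M}
    (h : Propto x (y + z)) : ∃ s t : M, x = s + t ∧ Propto s y ∧ Propto t z := by
  obtain ⟨n, hn, h⟩ := h
  rw [nsmul_add] at h
  obtain ⟨s, t, hx, hs, ht⟩ := href.exists_add_of_algLE_add h
  exact ⟨s, t, hx, ⟨n, hn, hs⟩, ⟨n, hn, ht⟩⟩

/-- In a refinement monoid, an element `x ∝ c` is a finite sum of elements below `c`. -/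
theorem IsRefinementMonoid.induction_of_propto (href : IsRefinementMonoid M) {c x : M}
    (h : Propto x c) (Q : M → Prop) (hadd : ∀ y z, Q y → Q z → Q (y + z))
    (hQ : ∀ y, AlgLE y c → AlgLE y x → Q y) : Q x := by
  obtain ⟨n, -, h⟩ := h
  induction n generalizing x with
  | zero =>
    rw [zero_nsmul] at h
    exact hQ x (h.trans ⟨c, zero_add c⟩) (AlgLE.refl _)
  | succ n ih =>
    rw [succ_nsmul] at h
    obtain ⟨s, t, rfl, hs, ht⟩ := href.exists_add_of_algLE_add h
    exact hadd s t (ih (fun y hyc hys => hQ y hyc (hys.trans (AlgLE.add_right s t))) hs)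
      (hQ t ht (AlgLE.add_left t s))

/-- In a refinement monoid, an element `x` with `x ∝ c` and `x ∝ d` satisfies `x ∝ e` for some
common lower bound `e` of `c` and `d`. -/
theorem IsRefinementMonoid.exists_algLE_algLE_propto (href : IsRefinementMonoid M) {c d x : M}
    (hc : Propto x c) (hd : Propto x d) : ∃ e, AlgLE e c ∧ AlgLE e d ∧ Propto x e := by
  have hadd : ∀ y z : M, (∃ e, AlgLE e c ∧ AlgLE e d ∧ Propto y e) →
      (∃ e, AlgLE e c ∧ AlgLE e d ∧ Propto z e) →
      ∃ e, AlgLE e c ∧ AlgLE e d ∧ Propto (y + z) e := by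
    rintro y z ⟨e, ⟨r, hr⟩, ⟨r', hr'⟩, hy⟩ ⟨f, hfc, hfd, hz⟩
    rw [← hr] at hfc
    obtain ⟨p, q, rfl, hp, hq⟩ := href.exists_add_of_algLE_add hfc
    have hqd : AlgLE q (e + r') := hr' ▸ (AlgLE.add_left q p).trans hfd
    obtain ⟨s, t, rfl, hs, ht⟩ := href.exists_add_of_algLE_add hqd
    have he : Propto e (e + t) := (AlgLE.add_right e t).propto
    refine ⟨e + t, hr ▸ (AlgLE.refl _).add ((AlgLE.add_left t s).trans hq),
      hr' ▸ (AlgLE.refl _).add ht, (hy.trans he).add (hz.trans ?_)⟩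
    exact (hp.propto.trans he).add ((hs.propto.trans he).add (AlgLE.add_left t e).propto)
  refine href.induction_of_propto hc _ hadd fun y hyc hyx => ?_
  refine href.induction_of_propto (hyx.propto.trans hd) _ hadd fun z hzd hzy => ?_
  exact ⟨z, hzy.trans hyc, hzd, (AlgLE.refl _).propto⟩

/-- Distributivity of the ideal lattice of a refinement monoid, for the entries of a
refinement matrix. -/
theorem IsRefinementMonoid.exists_propto_diagonal (href : IsRefinementMonoid M)
    {a c₀₀ c₀₁ c₁₀ c₁₁ : M} (hr₀ : Propto a (c₀₀ + c₀₁)) (hr₁ : Propto a (c₁₀ + c₁₁))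
    (hc₀ : Propto a (c₀₀ + c₁₀)) (hc₁ : Propto a (c₀₁ + c₁₁)) :
    ∃ x y : M, a = x + y ∧ Propto x c₀₀ ∧ Propto x c₁₁ ∧ Propto y c₀₁ ∧ Propto y c₁₀ := by
  obtain ⟨p, q, ha, hp, hq⟩ := href.exists_add_of_propto_add hr₀
  have hpa : Propto p a := ha ▸ (AlgLE.add_right p q).propto
  have hqa : Propto q a := ha ▸ (AlgLE.add_left q p).propto
  obtain ⟨p₁, p₂, rfl, hp₁, hp₂⟩ := href.exists_add_of_propto_add (hpa.trans hr₁)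
  obtain ⟨q₁, q₂, rfl, hq₁, hq₂⟩ := href.exists_add_of_propto_add (hqa.trans hr₁)
  have hp₁' : Propto p₁ (p₁ + p₂) := (AlgLE.add_right p₁ p₂).propto
  have hp₂' : Propto p₂ (p₁ + p₂) := (AlgLE.add_left p₂ p₁).propto
  have hq₁' : Propto q₁ (q₁ + q₂) := (AlgLE.add_right q₁ q₂).propto
  have hq₂' : Propto q₂ (q₁ + q₂) := (AlgLE.add_left q₂ q₁).propto
  obtain ⟨s, t, rfl, hs, ht⟩ :=
    href.exists_add_of_propto_add ((hp₁'.trans hpa).trans hc₁)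
  obtain ⟨v, w, rfl, hv, hw⟩ :=
    href.exists_add_of_propto_add ((hq₂'.trans hqa).trans hc₀)
  have hs' : Propto s (s + t) := (AlgLE.add_right s t).propto
  have ht' : Propto t (s + t) := (AlgLE.add_left t s).propto
  have hv' : Propto v (v + w) := (AlgLE.add_right v w).propto
  have hw' : Propto w (v + w) := (AlgLE.add_left w v).propto
  refine ⟨p₂ + (t + v), s + (q₁ + w), ?_, ?_, ?_, ?_, ?_⟩
  · rw [ha]
    abel
  · exact (hp₂'.trans hp).add (((ht'.trans hp₁').trans hp).add hv)
  · exact hp₂.add (ht.add (hv'.trans hq₂))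
  · exact hs.add ((hq₁'.trans hq).add ((hw'.trans hq₂').trans hq))
  · exact (hs'.trans hp₁).add (hq₁.add hw)

/-- In a quasi-divisible monoid every element splits into two summands each dominating it. -/
theorem IsQuasiDivisible.exists_add (hqd : IsQuasiDivisible M) (x : M) :
    ∃ y z : M, x = y + z ∧ Propto x y ∧ Propto x z := by
  obtain ⟨u, v, rfl⟩ := hqd x
  refine ⟨u + v, u + 2 • v, by abel, ⟨3, by norm_num, ⟨u, by abel⟩⟩,
    ⟨2, by norm_num, ⟨v, by abel⟩⟩⟩

/-- In a quasi-divisible monoid one can write `x = 2 • u + 3 • v` with both `u` and `v`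
dominating `x`. -/
theorem IsQuasiDivisible.exists_propto (hqd : IsQuasiDivisible M) (x : M) :
    ∃ u v : M, 2 • u + 3 • v = x ∧ Propto x u ∧ Propto x v := by
  have hcube : ∃ p q r s : M, 8 • p + 12 • q + 18 • r + 27 • s = x := by
    obtain ⟨u, v, rfl⟩ := hqd x
    obtain ⟨u₀, u₁, rfl⟩ := hqd u
    obtain ⟨v₀, v₁, rfl⟩ := hqd v
    obtain ⟨p₀, p₁, rfl⟩ := hqd u₀
    obtain ⟨q₀, q₁, rfl⟩ := hqd u₁
    obtain ⟨r₀, r₁, rfl⟩ := hqd v₀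
    obtain ⟨s₀, s₁, rfl⟩ := hqd v₁
    exact ⟨p₀, p₁ + q₀ + r₀, q₁ + r₁ + s₀, s₁, by abel⟩
  obtain ⟨p, q, r, s, rfl⟩ := hcube
  refine ⟨p + 3 • q + 3 • r + 3 • s, 2 • p + 2 • q + 4 • r + 7 • s, by abel,
    ⟨9, by norm_num, ⟨p + 15 • q + 9 • r, by abel⟩⟩,
    ⟨6, by norm_num, ⟨4 • p + 6 • r + 15 • s, by abel⟩⟩⟩

/-- A refinement of elements equivalent to `a` can be chosen with entries equivalent to `a`. -/
theorem IsRefinementMonoid.exists_refinement_asymp (href : IsRefinementMonoid M)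
    (hqd : IsQuasiDivisible M) {a a₀ a₁ b₀ b₁ : M} (h : a₀ + a₁ = b₀ + b₁)
    (ha₀ : Asymp a₀ a) (ha₁ : Asymp a₁ a) (hb₀ : Propto a b₀) (hb₁ : Propto a b₁) :
    ∃ c₀₀ c₀₁ c₁₀ c₁₁ : M,
      (a₀ = c₀₀ + c₀₁ ∧ a₁ = c₁₀ + c₁₁ ∧ b₀ = c₀₀ + c₁₀ ∧ b₁ = c₀₁ + c₁₁) ∧
      Asymp c₀₀ a ∧ Asymp c₀₁ a ∧ Asymp c₁₀ a ∧ Asymp c₁₁ a := by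
  obtain ⟨c₀₀, c₀₁, c₁₀, c₁₁, rfl, rfl, rfl, rfl⟩ := href a₀ a₁ b₀ b₁ h
  obtain ⟨x, y, hxy, hx₀, hx₁, hy₀, hy₁⟩ :=
    href.exists_propto_diagonal ha₀.2 ha₁.2 hb₀ hb₁
  obtain ⟨e, ⟨g₀₀, rfl⟩, ⟨g₁₁, rfl⟩, he⟩ := href.exists_algLE_algLE_propto hx₀ hx₁
  obtain ⟨f, ⟨g₀₁, rfl⟩, ⟨g₁₀, rfl⟩, hf⟩ := href.exists_algLE_algLE_propto hy₀ hy₁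
  obtain ⟨e₀, e₁, rfl, he₀, he₁⟩ := hqd.exists_add e
  obtain ⟨f₀, f₁, rfl, hf₀, hf₁⟩ := hqd.exists_add f
  have hdom₀ : ∀ g, Propto a (g + e₁ + f₀) := fun g =>
    hxy ▸ ((he.trans he₁).trans (AlgLE.propto ⟨g + f₀, by abel⟩)).add
      ((hf.trans hf₀).trans (AlgLE.propto ⟨g + e₁, by abel⟩))
  have hdom₁ : ∀ g, Propto a (g + f₁ + e₀) := fun g =>
    hxy ▸ ((he.trans he₀).trans (AlgLE.propto ⟨g + f₁, by abel⟩)).add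
      ((hf.trans hf₁).trans (AlgLE.propto ⟨g + e₀, by abel⟩))
  refine ⟨g₀₀ + e₁ + f₀, g₀₁ + f₁ + e₀, g₁₀ + f₁ + e₀, g₁₁ + e₁ + f₀,
    ⟨by abel, by abel, by abel, by abel⟩,
    ⟨Propto.trans (AlgLE.propto ⟨g₀₁ + f₁ + e₀, by abel⟩) ha₀.1, hdom₀ _⟩,
    ⟨Propto.trans (AlgLE.propto ⟨g₀₀ + e₁ + f₀, by abel⟩) ha₀.1, hdom₁ _⟩,
    ⟨Propto.trans (AlgLE.propto ⟨g₁₁ + e₁ + f₀, by abel⟩) ha₁.1, hdom₁ _⟩,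
    ⟨Propto.trans (AlgLE.propto ⟨g₁₀ + f₁ + e₀, by abel⟩) ha₁.1, hdom₀ _⟩⟩

/-- The submonoid `M(a) = {x | x ≍ a} ∪ {0}`. -/
def asympSubmonoid (a : M) : AddSubmonoid M where
  carrier := {x : M | Asymp x a} ∪ {0}
  zero_mem' := Or.inr rfl
  add_mem' := by
    rintro x y (hx | rfl) (hy | rfl)
    · exact Or.inl ⟨hx.1.add hy.1, hx.2.trans (AlgLE.add_right x y).propto⟩
    · rw [add_zero]
      exact Or.inl hx
    · rw [zero_add]
      exact Or.inl hy
    · exact Or.inr (add_zero 0)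

theorem isSimpleMonoid_asympSubmonoid (a : M) : IsSimpleMonoid (asympSubmonoid a) := by
  rintro ⟨u, hu⟩ hu0 ⟨x, hx⟩
  rcases hu with hu | rfl
  · have hxu : Propto x u := by
      rcases hx with hx | rfl
      · exact hx.1.trans hu.2
      · exact AlgLE.propto ⟨u, zero_add u⟩
    obtain ⟨n, -, z, hz⟩ := hxu
    have hle : AlgLE (z + u) ((n + 1) • u) := ⟨x, by rw [succ_nsmul, ← hz]; abel⟩
    refine ⟨n + 1, n.succ_pos, ⟨z + u, Or.inl ⟨Propto.trans ⟨n + 1, n.succ_pos, hle⟩ hu.1,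
      hu.2.trans (AlgLE.add_left u z).propto⟩⟩, Subtype.ext ?_⟩
    change x + (z + u) = (n + 1) • u
    rw [succ_nsmul, ← hz, add_assoc]
  · exact absurd (AlgLE.refl _) hu0

theorem IsQuasiDivisible.asympSubmonoid (hqd : IsQuasiDivisible M) (a : M) :
    IsQuasiDivisible (asympSubmonoid a) := by
  rintro ⟨x, hx | rfl⟩
  · obtain ⟨u, v, rfl, hu, hv⟩ := hqd.exists_propto x
    have hux : Propto u (2 • u + 3 • v) := AlgLE.propto ⟨u + 3 • v, by abel⟩
    have hvx : Propto v (2 • u + 3 • v) := AlgLE.propto ⟨2 • u + 2 • v, by abel⟩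
    exact ⟨⟨u, Or.inl ⟨hux.trans hx.1, hx.2.trans hu⟩⟩,
      ⟨v, Or.inl ⟨hvx.trans hx.1, hx.2.trans hv⟩⟩, rfl⟩
  · exact ⟨0, 0, by simp only [nsmul_zero, add_zero]; rfl⟩

theorem IsRefinementMonoid.asympSubmonoid (href : IsRefinementMonoid M)
    (hqd : IsQuasiDivisible M) (a : M) : IsRefinementMonoid (asympSubmonoid a) := by
  intro a₀ a₁ b₀ b₁ h
  rcases a₀.2 with ha₀ | ha₀
  · rcases a₁.2 with ha₁ | ha₁
    · rcases b₀.2 with hb₀ | hb₀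
      · rcases b₁.2 with hb₁ | hb₁
        · obtain ⟨c₀₀, c₀₁, c₁₀, c₁₁, ⟨h₁, h₂, h₃, h₄⟩, h₀₀, h₀₁, h₁₀, h₁₁⟩ :=
            href.exists_refinement_asymp hqd (congrArg Subtype.val h) ha₀ ha₁ hb₀.2 hb₁.2
          exact ⟨⟨c₀₀, Or.inl h₀₀⟩, ⟨c₀₁, Or.inl h₀₁⟩, ⟨c₁₀, Or.inl h₁₀⟩, ⟨c₁₁, Or.inl h₁₁⟩,
            Subtype.ext h₁, Subtype.ext h₂, Subtype.ext h₃, Subtype.ext h₄⟩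
        · obtain rfl : b₁ = 0 := Subtype.ext hb₁
          exact ⟨a₀, 0, a₁, 0, by simp, by simp, by simpa using h.symm, by simp⟩
      · obtain rfl : b₀ = 0 := Subtype.ext hb₀
        exact ⟨0, a₀, 0, a₁, by simp, by simp, by simp, by simpa using h.symm⟩
    · obtain rfl : a₁ = 0 := Subtype.ext ha₁
      exact ⟨b₀, b₁, 0, 0, by simpa using h, by simp, by simp, by simp⟩
  · obtain rfl : a₀ = 0 := Subtype.ext ha₀
    exact ⟨0, 0, b₀, b₁, by simp, by simpa using h, by simp, by simp⟩

theorem IsConical.addSubmonoid (hM : IsConical M) (S : AddSubmonoid M) : IsConical S :=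
  fun x y h =>
    have h' := hM x y (congrArg Subtype.val h)
    ⟨Subtype.ext h'.1, Subtype.ext h'.2⟩

theorem IsSeparative.addSubmonoid (hsep : IsSeparative M) (S : AddSubmonoid M) :
    IsSeparative S :=
  fun x y h h' =>
    Subtype.ext (hsep x y (congrArg Subtype.val h) (congrArg Subtype.val h'))

end

/-- If `M` is a separative quasi-divisible refinement cone and `a ∈ M`,
then `M(a)` is a simple, separative, quasi-divisible refinement cone. -/
theorem local_submonoid_of_separative_quasiDivisible_refinement_cone
    (M : Type u) [AddCommMonoid M] (hM : IsConical M)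
    (hsep : IsSeparative M) (hqd : IsQuasiDivisible M) (href : IsRefinementMonoid M)
    (a : M) :
    ∃ S : AddSubmonoid M,
      (S : Set M) = {x : M | Asymp x a} ∪ {0} ∧
      IsConical S ∧ IsSimpleMonoid S ∧ IsSeparative S ∧
      IsQuasiDivisible S ∧ IsRefinementMonoid S := by
  exact ⟨asympSubmonoid a, rfl, hM.addSubmonoid _, isSimpleMonoid_asympSubmonoid a,
    hsep.addSubmonoid _, hqd.asympSubmonoid a, href.asympSubmonoid hqd a⟩
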